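/- If the Turing machine T halts, then for each i ∈ {0,1,2} the class M_i = Mod_{V(A'(T))}(∃m̄ e_i(m̄,x) ≈ x) of all algebras in V(A'(T)) satisfying ∃m̄ [e_i(m̄,x) ≈ x] has definable principal subcongruences. -/

import Mathlib

open FirstOrder

namespace McKenzie

/-- A Turing machine instruction `(s, r, w, d, t)`: "in state `s` reading `r`,
write `w`, move in direction `d` (`true` = right, `false` = left), enter state `t`". -/
structure Instr (n : ℕ) where
  s : Fin (n + 1)
  r : Bool
  w : Bool
  d : Bool
  t : Fin (n + 1)

/-- A Turing machine: a finite list of instructions on states `μ0, …, μn`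
(represented by `Fin (states+1)`), where `μ0` is the halting state (carrying no
instructions) and `μ1` is the initial state. -/
structure TM where
  states : ℕ
  instr : List (Instr states)
  halt_no_instr : ∀ i ∈ instr, i.s ≠ 0

/-- A configuration of a Turing machine: a tape, a head position and a state. -/
structure Cfg (T : TM) where
  tape : ℤ → Bool
  head : ℤ
  state : Fin (T.states + 1)

/-- One computation step of the machine (using the first applicable instruction). -/
def TM.step (T : TM) (Q : Cfg T) : Option (Cfg T) :=
  match T.instr.find? (fun i => decide (i.s = Q.state ∧ i.r = Q.tape Q.head)) with
  | none => none
  | some i =>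
      some ⟨Function.update Q.tape Q.head i.w,
        if i.d then Q.head + 1 else Q.head - 1, i.t⟩

/-- The configuration after `n` steps when started in state `μ1` on the blank tape. -/
def TM.run (T : TM) : ℕ → Option (Cfg T)
  | 0 => some ⟨fun _ => false, 0, 1⟩
  | n + 1 => (T.run n).bind T.step

/-- `T` halts (started in the initial state `μ1` on the empty, all-zero, tape). -/
def TM.Halts (T : TM) : Prop := ∃ (n : ℕ) (Q : Cfg T), T.run n = some Q ∧ Q.state = 0

/-- The universe of the algebra `A'(T)`:
`0`, `U = {1,2,H}`, `W = {C, D, ∂C, ∂D}`, and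
`V = {C_ir^s, D_ir^s, M_i^r}` together with their barred versions. -/
inductive El (T : TM) : Type
  | zero
  | one
  | two
  | H
  | C (bar : Bool)
  | D (bar : Bool)
  | Cv (bar : Bool) (i : Fin (T.states + 1)) (r s : Bool)
  | Dv (bar : Bool) (i : Fin (T.states + 1)) (r s : Bool)
  | Mv (bar : Bool) (i : Fin (T.states + 1)) (r : Bool)
  deriving DecidableEq

namespace El

variable {T : TM}

/-- The bar involution `∂`, defined (only) on `V ∪ W`. -/
def bar : El T → Option (El T)
  | C b => some (C (!b))
  | D b => some (D (!b))
  | Cv b i r s => some (Cv (!b) i r s)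
  | Dv b i r s => some (Dv (!b) i r s)
  | Mv b i r => some (Mv (!b) i r)
  | _ => none

/-- The flat (height 1) semilattice meet with bottom element `0`. -/
def meet (x y : El T) : El T := if x = y then x else zero

/-- Join in the flat semilattice, for comparable elements. -/
def fjoin (x y : El T) : El T := if x = zero then y else x

/-- The nonassociative multiplication: `2·D = H·C = D`, `1·C = C`,
`2·∂D = H·∂C = ∂D`, `1·∂C = ∂C`, and `0` otherwise. -/
def mul : El T → El T → El T
  | two, D b => D b
  | H, C b => D b
  | one, C b => C b
  | _, _ => zero

/-- `J(x,y,z) = (x ∧ ∂y ∧ z) ∨ (x ∧ y)`. -/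
def opJ (x y z : El T) : El T :=
  if x = y then x else if bar y = some x then meet x z else zero

/-- `J'(x,y,z) = (x ∧ y ∧ z) ∨ (x ∧ ∂y)`. -/
def opJ' (x y z : El T) : El T :=
  if x = y then meet x z else if bar y = some x then x else zero

/-- `K(x,y,z) = (∂x ∧ y) ∨ (∂x ∧ ∂y ∧ z) ∨ (x ∧ y ∧ z)`. -/
def opK (x y z : El T) : El T :=
  if bar y = some x then y
  else if x = y ∧ bar z = some x then z
  else meet x (meet y z)

/-- `(x ∧ y) ∨ (x ∧ z)`. -/
def sCore (x y z : El T) : El T := fjoin (meet x y) (meet x z)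

/-- Membership in `V₀` (the elements of `V` with state index `0`). -/
def isV0 : El T → Bool
  | Cv _ i _ _ => decide (i = 0)
  | Dv _ i _ _ => decide (i = 0)
  | Mv _ i _ => decide (i = 0)
  | _ => false

/-- `S₀(u,x,y,z) = (x∧y) ∨ (x∧z)` if `u ∈ V₀`, else `0`. -/
def opS0 (u x y z : El T) : El T := if isV0 u then sCore x y z else zero

/-- `S₁(u,x,y,z) = (x∧y) ∨ (x∧z)` if `u ∈ {1,2}`, else `0`. -/
def opS1 (u x y z : El T) : El T := if u = one ∨ u = two then sCore x y z else zero

/-- `S₂(u,v,x,y,z) = (x∧y) ∨ (x∧z)` if `u = ∂v ∈ V ∪ W`, else `0`. -/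
def opS2 (u v x y z : El T) : El T := if bar v = some u then sCore x y z else zero

/-- The operation `T(w,x,y,z)`. -/
def opT (w x y z : El T) : El T :=
  if mul w x = mul y z then
    if w = y ∧ x = z then mul w x
    else if mul w x ≠ zero then (bar (mul w x)).getD zero else zero
  else zero

/-- `I(1) = C₁₀⁰`, `I(H) = M₁⁰`, `I(2) = D₁₀⁰`, and `0` otherwise. -/
def opI : El T → El T
  | one => Cv false 1 false false
  | H => Mv false 1 false
  | two => Dv false 1 false false
  | _ => zero

/-- The left-moving machine operation `L_{irt}` attached to an instruction
`(μ_i, r, s, L, μ_j)` and `t ∈ {0,1}`. -/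
def opL (ins : Instr T.states) (t : Bool) : El T → El T → El T → El T
  | one, one, Cv b i r s' => if i = ins.s ∧ r = ins.r then Cv b ins.t t s' else zero
  | H, one, Cv b i r s' => if i = ins.s ∧ r = ins.r ∧ s' = t then Mv b ins.t t else zero
  | two, H, Mv b i r => if i = ins.s ∧ r = ins.r then Dv b ins.t t ins.w else zero
  | two, two, Dv b i r s' => if i = ins.s ∧ r = ins.r then Dv b ins.t t s' else zero
  | _, _, _ => zero

/-- The right-moving machine operation `R_{irt}` attached to an instruction
`(μ_i, r, s, R, μ_j)` and `t ∈ {0,1}`. -/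
def opR (ins : Instr T.states) (t : Bool) : El T → El T → El T → El T
  | one, one, Cv b i r s' => if i = ins.s ∧ r = ins.r then Cv b ins.t t s' else zero
  | H, one, Mv b i r => if i = ins.s ∧ r = ins.r then Cv b ins.t t ins.w else zero
  | two, H, Dv b i r s' => if i = ins.s ∧ r = ins.r ∧ s' = t then Mv b ins.t t else zero
  | two, two, Dv b i r s' => if i = ins.s ∧ r = ins.r then Dv b ins.t t s' else zero
  | _, _, _ => zero

/-- The machine operation (from `𝓛 ∪ 𝓡`) attached to an instruction. -/
def mach (ins : Instr T.states) (t : Bool) (x y u : El T) : El T :=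
  if ins.d then opR ins t x y u else opL ins t x y u

/-- The relation `≺` on `{1,2,H}`. -/
def prec : El T → El T → Bool
  | two, two => true
  | two, H => true
  | one, one => true
  | _, _ => false

/-- The operation `U_F^1`. -/
def opU1 (F : El T → El T → El T → El T) (x y z u : El T) : El T :=
  if prec x z then
    if y = z then F x y u
    else if F x y u ≠ zero then (bar (F x y u)).getD zero else zero
  else zero

/-- The operation `U_F^0`. -/
def opU0 (F : El T → El T → El T → El T) (x y z u : El T) : El T :=
  if prec x z then
    if x = y then F y z u
    else if F y z u ≠ zero then (bar (F y z u)).getD zero else zero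
  else zero

end El

/-- The unary operation symbols of `A'(T)`. -/
inductive Ops1 : Type
  | I

/-- The binary operation symbols of `A'(T)`. -/
inductive Ops2 : Type
  | meet
  | mul

/-- The ternary operation symbols of `A'(T)`: `J`, `J'`, `K` and the machine
operations from `𝓛 ∪ 𝓡` (one for each instruction and each `t ∈ {0,1}`). -/
inductive Ops3 (T : TM) : Type
  | J
  | J'
  | K
  | mach (k : Fin T.instr.length) (t : Bool)

/-- The 4-ary operation symbols of `A'(T)`: `S₀`, `S₁`, `T` and the operations
`U_F^1, U_F^0` for `F ∈ 𝓛 ∪ 𝓡`. -/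
inductive Ops4 (T : TM) : Type
  | S0
  | S1
  | T
  | u1 (k : Fin T.instr.length) (t : Bool)
  | u0 (k : Fin T.instr.length) (t : Bool)

/-- The 5-ary operation symbols of `A'(T)`: `S₂`. -/
inductive Ops5 : Type
  | S2

/-- The signature (similarity type) of the algebra `A'(T)`; the constant symbol
(of arity 0) denotes the bottom element `0`. -/
def Sig (T : TM) : FirstOrder.Language.{0, 0} where
  Functions n :=
    match n with
    | 0 => PUnit
    | 1 => Ops1
    | 2 => Ops2
    | 3 => Ops3 T
    | 4 => Ops4 T
    | 5 => Ops5
    | _ => PEmpty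
  Relations _ := PEmpty


/-- The constant symbol `0` as an element of the signature. -/
def fn0 (T : TM) : (Sig T).Functions 0 := PUnit.unit
/-- Unary operation symbols as elements of the signature. -/
def fn1 (T : TM) (o : Ops1) : (Sig T).Functions 1 := o
/-- Binary operation symbols as elements of the signature. -/
def fn2 (T : TM) (o : Ops2) : (Sig T).Functions 2 := o
/-- Ternary operation symbols as elements of the signature. -/
def fn3 (T : TM) (o : Ops3 T) : (Sig T).Functions 3 := o
/-- 4-ary operation symbols as elements of the signature. -/
def fn4 (T : TM) (o : Ops4 T) : (Sig T).Functions 4 := o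
/-- 5-ary operation symbols as elements of the signature. -/
def fn5 (T : TM) (o : Ops5) : (Sig T).Functions 5 := o

/-- The algebra `A'(T)`: the interpretation of the signature `Sig T` on `El T`. -/
instance elStructure (T : TM) : (Sig T).Structure (El T) where
  funMap {n} f v :=
    match n, f, v with
    | 0, _, _ => El.zero
    | 1, Ops1.I, v => El.opI (v 0)
    | 2, Ops2.meet, v => El.meet (v 0) (v 1)
    | 2, Ops2.mul, v => El.mul (v 0) (v 1)
    | 3, Ops3.J, v => El.opJ (v 0) (v 1) (v 2)
    | 3, Ops3.J', v => El.opJ' (v 0) (v 1) (v 2)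
    | 3, Ops3.K, v => El.opK (v 0) (v 1) (v 2)
    | 3, Ops3.mach k t, v => El.mach (T.instr.get k) t (v 0) (v 1) (v 2)
    | 4, Ops4.S0, v => El.opS0 (v 0) (v 1) (v 2) (v 3)
    | 4, Ops4.S1, v => El.opS1 (v 0) (v 1) (v 2) (v 3)
    | 4, Ops4.T, v => El.opT (v 0) (v 1) (v 2) (v 3)
    | 4, Ops4.u1 k t, v => El.opU1 (El.mach (T.instr.get k) t) (v 0) (v 1) (v 2) (v 3)
    | 4, Ops4.u0 k t, v => El.opU0 (El.mach (T.instr.get k) t) (v 0) (v 1) (v 2) (v 3)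
    | 5, Ops5.S2, v => El.opS2 (v 0) (v 1) (v 2) (v 3) (v 4)
    | _ + 6, f, _ => f.elim
  RelMap {n} r _ := r.elim

/-- The product algebra `A'(T)^ι`. -/
instance piStructure (T : TM) (ι : Type*) : (Sig T).Structure (ι → El T) where
  funMap f v l := Language.Structure.funMap f fun i => v i l
  RelMap r _ := r.elim

open Language

/-- A congruence of an algebra: an equivalence relation compatible with all the
fundamental operations. -/
def IsCongruence (L : Language) (B : Type*) [L.Structure B] (ρ : B → B → Prop) : Prop :=
  Equivalence ρ ∧
    ∀ {n : ℕ} (f : L.Functions n) (v w : Fin n → B),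
      (∀ i, ρ (v i) (w i)) → ρ (Structure.funMap f v) (Structure.funMap f w)

/-- `PrinCg L B a b x y` says that `(x, y)` lies in the principal congruence
`Cg^B(a,b)` generated by the pair `(a,b)`. -/
def PrinCg (L : Language) (B : Type*) [L.Structure B] (a b x y : B) : Prop :=
  ∀ ρ : B → B → Prop, IsCongruence L B ρ → ρ a b → ρ x y

/-- `B` satisfies every identity holding in `A`; by Birkhoff's theorem this says
exactly that `B` belongs to the variety generated by `A`. -/
def ModelsIdsOf (L : Language) (A : Type*) [L.Structure A] (B : Type*) [L.Structure B] : Prop :=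
  ∀ t₁ t₂ : L.Term ℕ,
    (∀ v : ℕ → A, t₁.realize v = t₂.realize v) →
    ∀ v : ℕ → B, t₁.realize v = t₂.realize v

/-- Membership in the variety `V(A'(T))` generated by `A'(T)`. -/
def InVariety (T : TM) (B : Type*) [(Sig T).Structure B] : Prop :=
  ModelsIdsOf (Sig T) (El T) B

/-- The variety `V(A'(T))` as a class of algebras. -/
def VClass (T : TM) : ∀ (B : Type) [inst : (Sig T).Structure B], Prop :=
  fun B inst => @InVariety T B inst

/-- `φ(w,x,y,z)` is a congruence formula for the class `C`: in every member of `C`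
it implies `(w,x) ∈ Cg(y,z)`. -/
def IsCongruenceFormula (L : Language) (C : ∀ (B : Type) [inst : L.Structure B], Prop)
    (φ : L.Formula (Fin 4)) : Prop :=
  ∀ (B : Type) [L.Structure B], C B → ∀ w x y z : B,
    φ.Realize ![w, x, y, z] → PrinCg L B y z w x

/-- The class `C` has definable principal subcongruences: there are congruence
formulas `Γ` and `ψ` such that any pair `a ≠ b` admits a subpair `c ≠ d` of
`Cg(a,b)` (witnessed by `Γ`) whose principal congruence is defined by `ψ`. -/
def HasDPSC (L : Language) (C : ∀ (B : Type) [inst : L.Structure B], Prop) : Prop :=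
  ∃ Γ ψ : L.Formula (Fin 4),
    IsCongruenceFormula L C Γ ∧ IsCongruenceFormula L C ψ ∧
      ∀ (B : Type) [L.Structure B], C B → ∀ a b : B, a ≠ b →
        ∃ c d : B, c ≠ d ∧ Γ.Realize ![c, d, a, b] ∧
          ∀ x y : B, PrinCg L B c d x y ↔ ψ.Realize ![x, y, c, d]

/-- The variety `V(A'(T))` is axiomatized by a finite set of identities
(which hold in `A'(T)`). -/
def FinitelyBased (T : TM) : Prop :=
  ∃ E : List ((Sig T).Term ℕ × (Sig T).Term ℕ),
    (∀ e ∈ E, ∀ v : ℕ → El T, e.1.realize v = e.2.realize v) ∧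
    ∀ (B : Type) [(Sig T).Structure B],
      (InVariety T B ↔ ∀ e ∈ E, ∀ v : ℕ → B, e.1.realize v = e.2.realize v)

/-- An algebra is subdirectly irreducible iff some pair `a ≠ b` (generating the
monolith) belongs to every nontrivial congruence. -/
def IsSI (L : Language) (B : Type*) [L.Structure B] : Prop :=
  ∃ a b : B, a ≠ b ∧ ∀ c d : B, c ≠ d → PrinCg L B c d a b

/-- An algebra is finitely subdirectly irreducible iff any two nontrivial principal
congruences have nontrivial intersection. -/
def IsFSI (L : Language) (B : Type*) [L.Structure B] : Prop :=
  ∀ a b c d : B, a ≠ b → c ≠ d →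
    ∃ x y : B, x ≠ y ∧ PrinCg L B a b x y ∧ PrinCg L B c d x y

/-- The residual bound of `V(A'(T))` is finite (`κ(A'(T)) < ω`): there is a finite
bound strictly larger than the cardinality of every subdirectly irreducible member. -/
def ResBoundFinite (T : TM) : Prop :=
  ∃ N : ℕ, ∀ (B : Type) [(Sig T).Structure B],
    InVariety T B → IsSI (Sig T) B → Finite B ∧ Nat.card B < N

/-- Membership in `HS(A'(T))`: homomorphic images of subalgebras of `A'(T)`. -/
def InHS (T : TM) (B : Type*) [(Sig T).Structure B] : Prop :=
  ∃ (S : (Sig T).Substructure (El T)) (f : S →[Sig T] B), Function.Surjective f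

/-- The constant `0` of an algebra in the signature of `A'(T)`. -/
def zeroB (T : TM) (B : Type*) [(Sig T).Structure B] : B :=
  Structure.funMap (fn0 T) (fun i : Fin 0 => i.elim0)

/-- The meet operation of an algebra in the signature of `A'(T)`. -/
def meetB (T : TM) {B : Type*} [(Sig T).Structure B] (x y : B) : B :=
  Structure.funMap (fn2 T Ops2.meet) ![x, y]

/-- The multiplication of an algebra in the signature of `A'(T)`. -/
def mulB (T : TM) {B : Type*} [(Sig T).Structure B] (x y : B) : B :=
  Structure.funMap (fn2 T Ops2.mul) ![x, y]

/-- The operation `I` of an algebra in the signature of `A'(T)`. -/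
def IB (T : TM) {B : Type*} [(Sig T).Structure B] (x : B) : B :=
  Structure.funMap (fn1 T Ops1.I) ![x]

/-- The operation `J` of an algebra in the signature of `A'(T)`. -/
def JB (T : TM) {B : Type*} [(Sig T).Structure B] (x y z : B) : B :=
  Structure.funMap (fn3 T Ops3.J) ![x, y, z]

/-- The operation `J'` of an algebra in the signature of `A'(T)`. -/
def J'B (T : TM) {B : Type*} [(Sig T).Structure B] (x y z : B) : B :=
  Structure.funMap (fn3 T Ops3.J') ![x, y, z]

/-- The operation `K` of an algebra in the signature of `A'(T)`. -/
def KB (T : TM) {B : Type*} [(Sig T).Structure B] (x y z : B) : B :=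
  Structure.funMap (fn3 T Ops3.K) ![x, y, z]

/-- The operation `S₂` of an algebra in the signature of `A'(T)`. -/
def S2B (T : TM) {B : Type*} [(Sig T).Structure B] (u v x y z : B) : B :=
  Structure.funMap (fn5 T Ops5.S2) ![u, v, x, y, z]

/-- The term `e₂(m,n,x) = S₂(m,n,x,x,x)`. -/
def e2B (T : TM) {B : Type*} [(Sig T).Structure B] (m n x : B) : B :=
  S2B T m n x x x

/-- The semilattice order of an algebra in the signature of `A'(T)`:
`x ≤ y` iff `x ∧ y = x`. -/
def leB (T : TM) {B : Type*} [(Sig T).Structure B] (x y : B) : Prop :=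
  meetB T x y = x

/-- Parameters `m̄ ∈ B² ∪ B` for one of the operations `S₀`, `S₁`, `S₂`. -/
inductive SIdx (B : Type*) : Type _
  | s0 (m : B)
  | s1 (m : B)
  | s2 (m n : B)

/-- Which of `S₀, S₁, S₂` a parameter tuple belongs to. -/
def SIdx.tag {B : Type*} : SIdx B → Fin 3
  | .s0 _ => 0
  | .s1 _ => 1
  | .s2 _ _ => 2

/-- `SApp T σ x y z` is `S_i(m̄, x, y, z)` where `σ` packages `i` and `m̄`. -/
def SApp (T : TM) {B : Type*} [(Sig T).Structure B] : SIdx B → B → B → B → B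
  | .s0 m, x, y, z => Structure.funMap (fn4 T Ops4.S0) ![m, x, y, z]
  | .s1 m, x, y, z => Structure.funMap (fn4 T Ops4.S1) ![m, x, y, z]
  | .s2 m n, x, y, z => S2B T m n x y z

/-- `eApp T σ x` is the term function `e_i(m̄, x) = S_i(m̄, x, x, x)`. -/
def eApp (T : TM) {B : Type*} [(Sig T).Structure B] (σ : SIdx B) (x : B) : B :=
  SApp T σ x x x

/-- `Range(S_j)`: the set of values of the operation `S_j` on `B`. -/
def SRange (T : TM) (B : Type*) [(Sig T).Structure B] (j : Fin 3) : Set B :=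
  {w | ∃ (σ : SIdx B) (x y z : B), σ.tag = j ∧ SApp T σ x y z = w}

/-- A unary polynomial of `B`: a term function in one variable with parameters
from `B`. -/
def IsPolynomial (T : TM) {B : Type*} [(Sig T).Structure B] (f : B → B) : Prop :=
  ∃ t : (Sig T).Term (B ⊕ Unit), ∀ x : B, f x = t.realize (Sum.elim id fun _ => x)

/-- A fundamental translation: a unary polynomial obtained from a fundamental
operation by fixing all arguments but one. -/
def IsFundTranslation (T : TM) {B : Type*} [(Sig T).Structure B] (g : B → B) : Prop :=
  ∃ (n : ℕ) (F : (Sig T).Functions n) (i : Fin n) (v : Fin n → B),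
    g = fun x => Structure.funMap F (Function.update v i x)

/-- A polynomial generated by fundamental translations: a composition of finitely
many fundamental translations. -/
inductive IsTransPoly (T : TM) {B : Type*} [(Sig T).Structure B] : (B → B) → Prop
  | id : IsTransPoly T id
  | comp {g f : B → B} : IsFundTranslation T g → IsTransPoly T f → IsTransPoly T (g ∘ f)

end McKenzie

namespace McKenzie

/-- The class `M_i = Mod_{V(A'(T))}(∃ m̄ [e_i(m̄,x) ≈ x])` of all algebras in the
variety `V(A'(T))` having parameters `m̄` with `e_i(m̄,x) = x` for all `x`
(where `e_i(m̄,x) = S_i(m̄,x,x,x)`). -/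
def MiClass (T : TM) (i : Fin 3) : ∀ (B : Type) [inst : (Sig T).Structure B], Prop :=
  fun B inst =>
    @InVariety T B inst ∧ ∃ σ : SIdx B, σ.tag = i ∧ ∀ x : B, @eApp T B inst σ x = x

section Congruences

open Language

variable {L : FirstOrder.Language.{0, 0}} {B : Type} [L.Structure B] {π : B → B → Prop}

theorem isCongruence_eq : IsCongruence L B Eq :=
  ⟨eq_equivalence, fun f _ _ h => congrArg (Structure.funMap f) (funext h)⟩

theorem IsCongruence.realize (hπ : IsCongruence L B π) {X : Type} (t : L.Term X) {v w : X → B}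
    (h : ∀ x, π (v x) (w x)) : π (t.realize v) (t.realize w) := by
  induction t with
  | var x => exact h x
  | func f ts ih => exact hπ.2 f _ _ ih

/-- An equivalence relation preserved by all fundamental translations is a congruence. -/
theorem isCongruence_of_translations (hπ : Equivalence π)
    (h : ∀ {n : ℕ} (f : L.Functions n) (v : Fin n → B) (i : Fin n) (x y : B), π x y →
      π (Structure.funMap f (Function.update v i x)) (Structure.funMap f (Function.update v i y))) :
    IsCongruence L B π := by
  refine ⟨hπ, fun {n} f v w hvw => ?_⟩
  have key : ∀ j ≤ n, π (Structure.funMap f v)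
      (Structure.funMap f fun i => if i.1 < j then w i else v i) := by
    intro j
    induction j with
    | zero => intro _; simpa using hπ.refl _
    | succ j ih =>
      intro hj
      refine hπ.trans (ih (by omega)) ?_
      have := h f (fun i => if i.1 < j then w i else v i) ⟨j, hj⟩ _ _ (hvw ⟨j, hj⟩)
      convert this using 2
      · funext i
        by_cases hi : i = ⟨j, hj⟩
        · subst hi; simp
        · simp [Function.update_of_ne hi]
      · funext i
        by_cases hi : i = ⟨j, hj⟩
        · subst hi; simp
        · have : i.1 ≠ j := fun h => hi (Fin.ext h)
          rw [Function.update_of_ne hi]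
          have : i.1 < j + 1 ↔ i.1 < j := by omega
          simp [this]
  simpa using key n le_rfl

/-- The largest congruence whose image under `g` is contained in `π`; it is enough to test
polynomials whose parameters lie in a set of representatives modulo `π`. -/
theorem isCongruence_polynomials (hπ : IsCongruence L B π) {g : B → B}
    (hg : ∀ x y, π x y → π (g x) (g y)) {X : Type} {v : X → B} (hv : ∀ z, ∃ x, π z (v x)) :
    IsCongruence L B fun p q => ∀ t : L.Term (X ⊕ Unit),
      π (g (t.realize (Sum.elim v fun _ => p))) (g (t.realize (Sum.elim v fun _ => q))) := by
  classical
  choose r hr using hv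
  refine isCongruence_of_translations ⟨fun _ _ => hπ.1.refl _, fun h t => hπ.1.symm (h t),
    fun h h' t => hπ.1.trans (h t) (h' t)⟩ fun f w i x y h t => ?_
  let t' : L.Term (X ⊕ Unit) := t.subst (Sum.elim (fun x => Term.var (Sum.inl x)) fun _ =>
    Term.func f fun j => if j = i then Term.var (Sum.inr ()) else Term.var (Sum.inl (r (w j))))
  have key : ∀ z, π (t.realize (Sum.elim v fun _ => Structure.funMap f (Function.update w i z)))
      (t'.realize (Sum.elim v fun _ => z)) := by
    intro z
    rw [Term.realize_subst]
    refine hπ.realize t ?_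
    rintro (x | _)
    · exact hπ.1.refl _
    · refine hπ.2 f _ _ fun j => ?_
      by_cases hj : j = i
      · subst hj; simpa using hπ.1.refl _
      · simpa [hj] using hr _
  exact hπ.1.trans (hg _ _ (key x)) (hπ.1.trans (h t') (hπ.1.symm (hg _ _ (key y))))

theorem IsCongruence.le_polynomials (hπ : IsCongruence L B π) {g : B → B}
    (hg : ∀ x y, π x y → π (g x) (g y)) {X : Type} {v : X → B} {p q : B} (h : π p q)
    (t : L.Term (X ⊕ Unit)) :
    π (g (t.realize (Sum.elim v fun _ => p))) (g (t.realize (Sum.elim v fun _ => q))) := by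
  refine hg _ _ (hπ.realize t ?_)
  rintro (x | _)
  exacts [hπ.1.refl _, h]

/-- `π` is maximal among the congruences that separate `a` and `b`. -/
def IsMaxSeparating (L : FirstOrder.Language.{0, 0}) {B : Type} [L.Structure B] (π : B → B → Prop)
    (a b : B) : Prop :=
  IsCongruence L B π ∧ ¬ π a b ∧
    ∀ θ : B → B → Prop, IsCongruence L B θ → (∀ x y, π x y → θ x y) →
      ∀ p q, θ p q → ¬ π p q → θ a b

theorem exists_isMaxSeparating {a b : B} (hab : a ≠ b) :
    ∃ π : B → B → Prop, IsMaxSeparating L π a b := by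
  obtain ⟨π, -, hπ⟩ := zorn_le_nonempty₀ {θ : B → B → Prop | IsCongruence L B θ ∧ ¬ θ a b}
    (by
      intro c hc hchain y hy
      refine ⟨fun p q => ∃ θ ∈ c, θ p q, ⟨isCongruence_of_translations ⟨?_, ?_, ?_⟩ ?_, ?_⟩, ?_⟩
      · exact fun x => ⟨y, hy, (hc hy).1.1.refl x⟩
      · rintro p q ⟨θ, hθ, h⟩
        exact ⟨θ, hθ, (hc hθ).1.1.symm h⟩
      · rintro p q s ⟨θ, hθ, h⟩ ⟨θ', hθ', h'⟩
        rcases hchain.total hθ hθ' with hle | hle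
        · exact ⟨θ', hθ', (hc hθ').1.1.trans (hle _ _ h) h'⟩
        · exact ⟨θ, hθ, (hc hθ).1.1.trans h (hle _ _ h')⟩
      · rintro n f v i p q ⟨θ, hθ, h⟩
        refine ⟨θ, hθ, (hc hθ).1.2 f _ _ fun j => ?_⟩
        by_cases hj : j = i
        · subst hj; simpa using h
        · simpa [hj] using (hc hθ).1.1.refl _
      · rintro ⟨θ, hθ, h⟩
        exact (hc hθ).2 h
      · exact fun θ hθ p q h => ⟨θ, hθ, h⟩)
    Eq ⟨isCongruence_eq, hab⟩
  refine ⟨π, hπ.prop.1, hπ.prop.2, fun θ hθ hle p q hpq hn => ?_⟩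
  by_contra hab'
  exact hn (hπ.le_of_ge (y := θ) ⟨hθ, hab'⟩ hle p q hpq)

end Congruences

section Terms

open Language

variable {L : FirstOrder.Language.{0, 0}}

theorem realize_congr_of_varFinset {B : Type} [L.Structure B] {X : Type} [DecidableEq X]
    (t : L.Term X) {v w : X → B} (h : ∀ x ∈ t.varFinset, v x = w x) :
    t.realize v = t.realize w := by
  induction t with
  | var x => exact h x (by simp [Term.varFinset])
  | func f ts ih =>
    refine congrArg (Structure.funMap f) (funext fun i => ih i fun x hx => h x ?_)
    simp only [Term.varFinset, Finset.mem_biUnion, Finset.mem_univ, true_and]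
    exact ⟨i, hx⟩

/-- Identities of `A` in an arbitrary set of variables hold in the variety generated by `A`. -/
theorem ModelsIdsOf.realize_eq {A B : Type} [L.Structure A] [L.Structure B]
    (hB : ModelsIdsOf L A B) {X : Type} {p q : L.Term X}
    (h : ∀ w : X → A, p.realize w = q.realize w) (v : X → B) : p.realize v = q.realize v := by
  classical
  let S := p.varFinset ∪ q.varFinset
  let g : X → ℕ := fun x => if hx : x ∈ S then (S.equivFin ⟨x, hx⟩).1 else 0
  have hg : ∀ x ∈ S, ∀ y ∈ S, g x = g y → x = y := by
    intro x hx y hy hxy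
    simp only [g, hx, hy, dif_pos] at hxy
    simpa using S.equivFin.injective (Fin.ext hxy)
  let w : ℕ → B := fun k => if hk : ∃ x ∈ S, g x = k then v hk.choose else p.realize v
  have hw : ∀ x ∈ S, v x = (w ∘ g) x := by
    intro x hx
    have hk : ∃ y ∈ S, g y = g x := ⟨x, hx, rfl⟩
    simp only [Function.comp, w, dif_pos hk]
    rw [hg _ hk.choose_spec.1 x hx hk.choose_spec.2]
  have := hB (p.relabel g) (q.relabel g) (fun u => by simpa using h (u ∘ g)) w
  rw [Term.realize_relabel, Term.realize_relabel] at this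
  rwa [realize_congr_of_varFinset p fun x hx => hw x (Finset.mem_union_left _ hx),
    realize_congr_of_varFinset q fun x hx => hw x (Finset.mem_union_right _ hx)]

/-- A finite algebra has finitely many term operations in a given finite set of variables. -/
theorem exists_finite_representatives (L : FirstOrder.Language.{0, 0}) (A : Type)
    [L.Structure A] [Finite A] (X : Type) [Finite X] :
    ∃ R : Set (L.Term X), R.Finite ∧
      ∀ t : L.Term X, ∃ r ∈ R, ∀ w : X → A, t.realize w = r.realize w := by
  let e : L.Term X → (X → A) → A := fun t w => t.realize w
  refine ⟨Set.range fun f : Set.range e => f.2.choose, Set.finite_range _, fun t => ?_⟩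
  have ht : ∃ s, e s = e t := ⟨t, rfl⟩
  exact ⟨ht.choose, ⟨⟨e t, ht⟩, rfl⟩, fun w => (congrFun ht.choose_spec w).symm⟩

/-- Each congruence, on any algebra of the variety generated by `A`, that identifies the values of
the first pair of terms also identifies the values of the second pair. -/
def Forces (L : FirstOrder.Language.{0, 0}) (A : Type) [L.Structure A] {X : Type}
    (p q : L.Term X × L.Term X) : Prop :=
  ∀ (C : Type) [L.Structure C], ModelsIdsOf L A C → ∀ θ : C → C → Prop, IsCongruence L C θ →
    ∀ w : X → C, θ (p.1.realize w) (p.2.realize w) → θ (q.1.realize w) (q.2.realize w)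

theorem Forces.realize_eq {A : Type} [L.Structure A] {X : Type} {p q : L.Term X × L.Term X}
    (h : Forces L A p q) {w : X → A} (hw : p.1.realize w = p.2.realize w) :
    q.1.realize w = q.2.realize w :=
  h A (fun _ _ h => h) Eq isCongruence_eq w hw

/-- `(x, y)` is the value of a pair of terms, in `a`, `b` and `n` parameters, whose equality
follows in `A` from `a = b`. -/
def TermRelated (L : FirstOrder.Language.{0, 0}) (A : Type) [L.Structure A] (n : ℕ)
    {B : Type} [L.Structure B] (x y a b : B) : Prop :=
  ∃ (v : Fin n → B) (P Q : L.Term (Fin 2 ⊕ Fin n)),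
    (∀ w : Fin 2 ⊕ Fin n → A, w (Sum.inl 0) = w (Sum.inl 1) → P.realize w = Q.realize w) ∧
    P.realize (Sum.elim ![a, b] v) = x ∧ Q.realize (Sum.elim ![a, b] v) = y

theorem TermRelated.of_card_le {A : Type} [L.Structure A] {n : ℕ} {B : Type} [L.Structure B]
    {x y a b : B} {Z : Type} [Finite Z] (hZ : Nat.card Z ≤ n) (v : Z → B)
    (P Q : L.Term (Fin 2 ⊕ Z))
    (h : ∀ w : Fin 2 ⊕ Z → A, w (Sum.inl 0) = w (Sum.inl 1) → P.realize w = Q.realize w)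
    (hP : P.realize (Sum.elim ![a, b] v) = x) (hQ : Q.realize (Sum.elim ![a, b] v) = y) :
    TermRelated L A n x y a b := by
  let f : Z → Fin n := fun z => Fin.castLE hZ (Finite.equivFin Z z)
  have hf : f.Injective := (Fin.castLE_injective hZ).comp (Finite.equivFin Z).injective
  have hv : Sum.elim ![a, b] (Function.extend f v fun _ => a) ∘ Sum.map id f =
      Sum.elim ![a, b] v := by
    funext z
    rcases z with z | z
    · rfl
    · simp [hf.extend_apply]
  refine ⟨Function.extend f v fun _ => a, P.relabel (Sum.map id f), Q.relabel (Sum.map id f),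
    fun w hw => ?_, ?_, ?_⟩
  · simpa using h (w ∘ Sum.map id f) hw
  · rw [Term.realize_relabel, hv, hP]
  · rw [Term.realize_relabel, hv, hQ]

theorem TermRelated.prinCg {A : Type} [L.Structure A] {n : ℕ} {B : Type} [L.Structure B]
    (hB : ModelsIdsOf L A B) {x y a b : B} (h : TermRelated L A n x y a b) :
    PrinCg L B a b x y := by
  obtain ⟨v, P, Q, hPQ, rfl, rfl⟩ := h
  intro θ hθ hab
  have key : ∀ t : L.Term (Fin 2 ⊕ Fin n),
      θ (t.realize (Sum.elim ![a, b] v)) (t.realize (Sum.elim ![a, a] v)) := by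
    refine fun t => hθ.realize t ?_
    rintro (i | i)
    · fin_cases i
      exacts [hθ.1.refl _, hθ.1.symm hab]
    · exact hθ.1.refl _
  have heq : P.realize (Sum.elim ![a, a] v) = Q.realize (Sum.elim ![a, a] v) := by
    let σ : Fin 2 ⊕ Fin n → L.Term (Fin 2 ⊕ Fin n) :=
      Sum.elim (fun _ => Term.var (Sum.inl 0)) fun i => Term.var (Sum.inr i)
    have := hB.realize_eq (p := P.subst σ) (q := Q.subst σ)
      (fun w => by simpa using hPQ _ rfl) (Sum.elim ![a, a] v)
    have hσ : (fun z => (σ z).realize (Sum.elim ![a, a] v)) = Sum.elim ![a, a] v := by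
      funext z
      rcases z with i | i
      · fin_cases i <;> rfl
      · rfl
    simpa [hσ] using this
  exact hθ.1.trans (key P) (heq ▸ hθ.1.symm (key Q))

theorem exists_termRelated_formula (L : FirstOrder.Language.{0, 0}) (A : Type)
    [L.Structure A] [Finite A] (n : ℕ) :
    ∃ φ : L.Formula (Fin 4), ∀ (B : Type) [L.Structure B], ModelsIdsOf L A B → ∀ x y a b : B,
      φ.Realize ![x, y, a, b] ↔ TermRelated L A n x y a b := by
  obtain ⟨R, hR, hrep⟩ := exists_finite_representatives L A (Fin 2 ⊕ Fin n)
  let F := {p : L.Term (Fin 2 ⊕ Fin n) × L.Term (Fin 2 ⊕ Fin n) // p ∈ R ×ˢ R ∧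
    ∀ w : Fin 2 ⊕ Fin n → A, w (Sum.inl 0) = w (Sum.inl 1) → p.1.realize w = p.2.realize w}
  have : Finite F := ((hR.prod hR).subset fun _ h => h.1).to_subtype
  let e : Fin 2 ⊕ Fin n → Fin 4 ⊕ Fin n := Sum.map ![2, 3] id
  have he : ∀ {B : Type} (x y a b : B) (v : Fin n → B),
      Sum.elim ![x, y, a, b] v ∘ e = Sum.elim ![a, b] v := by
    intro B x y a b v
    funext z
    rcases z with i | i
    · fin_cases i <;> rfl
    · rfl
  refine ⟨(Formula.iSup fun p : F =>
    Term.equal (p.1.1.relabel e) (Term.var (Sum.inl 0)) ⊓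
      Term.equal (p.1.2.relabel e) (Term.var (Sum.inl 1))).iExs (Fin n), fun B _ hB x y a b => ?_⟩
  rw [Formula.realize_iExs]
  simp only [Formula.realize_iSup, Formula.realize_inf, Formula.realize_equal,
    Term.realize_relabel, he, Term.realize_var, Sum.elim_inl]
  constructor
  · rintro ⟨v, ⟨⟨P, Q⟩, hmem, hPQ⟩, h₁, h₂⟩
    exact ⟨v, P, Q, hPQ, h₁, h₂⟩
  · rintro ⟨v, P, Q, hPQ, h₁, h₂⟩
    obtain ⟨P', hP', hPP'⟩ := hrep P
    obtain ⟨Q', hQ', hQQ'⟩ := hrep Q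
    refine ⟨v, ⟨(P', Q'), ⟨hP', hQ'⟩, fun w hw => ?_⟩, ?_, ?_⟩
    · rw [← hPP', ← hQQ', hPQ w hw]
    · rw [← hB.realize_eq hPP', h₁]; rfl
    · rw [← hB.realize_eq hQQ', h₂]; rfl

end Terms

section Operations

open Language

variable {T : TM}

/-- The operation `S_i`, with a dummy second parameter for `i = 0, 1`. -/
def sB (T : TM) {B : Type} [(Sig T).Structure B] (i : Fin 3) (m n x y z : B) : B :=
  match i with
  | 0 => Structure.funMap (fn4 T Ops4.S0) ![m, x, y, z]
  | 1 => Structure.funMap (fn4 T Ops4.S1) ![m, x, y, z]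
  | 2 => S2B T m n x y z

/-- The constant term `0`. -/
def zeroTm (T : TM) (X : Type) : (Sig T).Term X :=
  Term.func (fn0 T) fun i => i.elim0

/-- The meet of two terms. -/
def meetTm {X : Type} (p q : (Sig T).Term X) : (Sig T).Term X :=
  Term.func (fn2 T Ops2.meet) ![p, q]

/-- The operation `S_i` applied to terms. -/
def sTm {X : Type} (i : Fin 3) (m n p q r : (Sig T).Term X) : (Sig T).Term X :=
  match i with
  | 0 => Term.func (fn4 T Ops4.S0) ![m, p, q, r]
  | 1 => Term.func (fn4 T Ops4.S1) ![m, p, q, r]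
  | 2 => Term.func (fn5 T Ops5.S2) ![m, n, p, q, r]

variable {B : Type} [(Sig T).Structure B] {X : Type}

@[simp]
theorem realize_zeroTm (v : X → B) : (zeroTm T X).realize v = zeroB T B :=
  congrArg (Structure.funMap (M := B) (fn0 T)) (funext fun i => i.elim0)

@[simp]
theorem realize_meetTm (p q : (Sig T).Term X) (v : X → B) :
    (meetTm p q).realize v = meetB T (p.realize v) (q.realize v) := by
  refine congrArg (Structure.funMap (M := B) (fn2 T Ops2.meet)) (funext fun i => ?_)
  fin_cases i <;> rfl

@[simp]
theorem realize_sTm (i : Fin 3) (m n p q r : (Sig T).Term X) (v : X → B) :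
    (sTm i m n p q r).realize v =
      sB T i (m.realize v) (n.realize v) (p.realize v) (q.realize v) (r.realize v) := by
  fin_cases i
  · refine congrArg (Structure.funMap (M := B) (fn4 T Ops4.S0)) (funext fun j => ?_)
    fin_cases j <;> rfl
  · refine congrArg (Structure.funMap (M := B) (fn4 T Ops4.S1)) (funext fun j => ?_)
    fin_cases j <;> rfl
  · refine congrArg (Structure.funMap (M := B) (fn5 T Ops5.S2)) (funext fun j => ?_)
    fin_cases j <;> rfl

theorem exists_sB_of_tag {i : Fin 3} {σ : SIdx B} (hσ : σ.tag = i) :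
    ∃ m n : B, ∀ x : B, sB T i m n x x x = eApp T σ x := by
  subst hσ
  cases σ with
  | s0 m => exact ⟨m, m, fun _ => rfl⟩
  | s1 m => exact ⟨m, m, fun _ => rfl⟩
  | s2 m n => exact ⟨m, n, fun _ => rfl⟩

variable {π : B → B → Prop}

theorem IsCongruence.meetB (hπ : IsCongruence (Sig T) B π) {x x' y y' : B} (hx : π x x')
    (hy : π y y') : π (meetB T x y) (meetB T x' y') := by
  refine hπ.2 (n := 2) _ _ _ fun i => ?_
  fin_cases i
  exacts [hx, hy]

theorem IsCongruence.sB (hπ : IsCongruence (Sig T) B π) (i : Fin 3) {m n x x' y y' z z' : B}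
    (hx : π x x') (hy : π y y') (hz : π z z') : π (sB T i m n x y z) (sB T i m n x' y' z') := by
  fin_cases i
  · refine hπ.2 (n := 4) _ _ _ fun i => ?_
    fin_cases i
    exacts [hπ.1.refl _, hx, hy, hz]
  · refine hπ.2 (n := 4) _ _ _ fun i => ?_
    fin_cases i
    exacts [hπ.1.refl _, hx, hy, hz]
  · refine hπ.2 (n := 5) _ _ _ fun i => ?_
    fin_cases i
    exacts [hπ.1.refl _, hπ.1.refl _, hx, hy, hz]

theorem meetB_el (x y : El T) : meetB T x y = El.meet x y := rfl

theorem zeroB_el : zeroB T (El T) = El.zero := rfl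

/-- In `A'(T)` each `S_i(m̄, x, y, z)` is either `(x ∧ y) ∨ (x ∧ z)` or constantly `0`. -/
theorem sB_el (i : Fin 3) (m n : El T) :
    (∀ x y z, sB T i m n x y z = El.sCore x y z) ∨ ∀ x y z, sB T i m n x y z = El.zero := by
  fin_cases i
  · by_cases h : El.isV0 m = true
    · exact Or.inl fun x y z => if_pos h
    · exact Or.inr fun x y z => if_neg h
  · by_cases h : m = El.one ∨ m = El.two
    · exact Or.inl fun x y z => if_pos h
    · exact Or.inr fun x y z => if_neg h
  · by_cases h : El.bar n = some m
    · exact Or.inl fun x y z => if_pos h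
    · exact Or.inr fun x y z => if_neg h

variable (hB : InVariety T B)
include hB

theorem meetB_self (x : B) : meetB T x x = x := by
  simpa using hB.realize_eq (p := meetTm (Term.var 0) (Term.var 0)) (q := Term.var (0 : Fin 1))
    (fun w => by simp [meetB_el, El.meet]) ![x]

theorem meetB_comm (x y : B) : meetB T x y = meetB T y x := by
  simpa using hB.realize_eq (p := meetTm (Term.var 0) (Term.var 1))
    (q := meetTm (Term.var 1) (Term.var (0 : Fin 2)))
    (fun w => by simp only [realize_meetTm, Term.realize_var, meetB_el, El.meet]; grind) ![x, y]

theorem meetB_meetB_left (x y : B) : meetB T x (meetB T x y) = meetB T x y := by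
  simpa using hB.realize_eq (p := meetTm (Term.var 0) (meetTm (Term.var 0) (Term.var 1)))
    (q := meetTm (Term.var 0) (Term.var (1 : Fin 2)))
    (fun w => by simp only [realize_meetTm, Term.realize_var, meetB_el, El.meet]; grind) ![x, y]

theorem meetB_zero (x : B) : meetB T x (zeroB T B) = zeroB T B := by
  simpa using hB.realize_eq (p := meetTm (Term.var 0) (zeroTm T _)) (q := zeroTm T (Fin 1))
    (fun w => by simp [meetB_el, zeroB_el, El.meet]) ![x]

theorem sB_self_left (i : Fin 3) (m n x z : B) : sB T i m n x x z = sB T i m n x x x := by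
  simpa using hB.realize_eq
    (p := sTm i (Term.var 0) (Term.var 1) (Term.var 2) (Term.var 2) (Term.var 3))
    (q := sTm i (Term.var 0) (Term.var 1) (Term.var 2) (Term.var 2) (Term.var (2 : Fin 4)))
    (fun w => by
      rcases sB_el i (w 0) (w 1) with h | h
      · simp only [realize_sTm, Term.realize_var, h, El.sCore, El.meet, El.fjoin]
        grind
      · simp [h])
    ![m, n, x, z]

theorem sB_self_right (i : Fin 3) (m n x y : B) : sB T i m n x y x = sB T i m n x x x := by
  simpa using hB.realize_eq
    (p := sTm i (Term.var 0) (Term.var 1) (Term.var 2) (Term.var 3) (Term.var 2))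
    (q := sTm i (Term.var 0) (Term.var 1) (Term.var 2) (Term.var 2) (Term.var (2 : Fin 4)))
    (fun w => by
      rcases sB_el i (w 0) (w 1) with h | h
      · simp only [realize_sTm, Term.realize_var, h, El.sCore, El.meet, El.fjoin]
        grind
      · simp [h])
    ![m, n, x, y]

theorem sB_diag (i : Fin 3) (m n x y : B) :
    sB T i m n x y y = sB T i m n (meetB T x y) (meetB T x y) (meetB T x y) := by
  simpa using hB.realize_eq
    (p := sTm i (Term.var 0) (Term.var 1) (Term.var 2) (Term.var 3) (Term.var 3))
    (q := sTm i (Term.var 0) (Term.var 1) (meetTm (Term.var 2) (Term.var 3))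
      (meetTm (Term.var 2) (Term.var 3)) (meetTm (Term.var 2) (Term.var (3 : Fin 4))))
    (fun w => by
      rcases sB_el i (w 0) (w 1) with h | h
      · simp only [realize_sTm, realize_meetTm, Term.realize_var, h, meetB_el, El.sCore, El.meet,
          El.fjoin]
        grind
      · simp [h])
    ![m, n, x, y]

end Operations

section Irreducible

open Language

variable {T : TM} {B : Type} [(Sig T).Structure B] {π : B → B → Prop}

/-- `π` is maximal among the congruences separating some comparable pair. -/
def IsIrr (T : TM) {B : Type} [(Sig T).Structure B] (π : B → B → Prop) : Prop :=
  ∃ a b : B, meetB T a b = b ∧ IsMaxSeparating (Sig T) π a b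

theorem IsIrr.isCongruence (h : IsIrr T π) : IsCongruence (Sig T) B π :=
  let ⟨_, _, _, h⟩ := h
  h.1

theorem exists_isIrr (hB : InVariety T B) {p q : B} (hpq : p ≠ q) :
    ∃ π : B → B → Prop, IsIrr T π ∧ ¬ π p q := by
  have : p ≠ meetB T p q ∨ q ≠ meetB T q p := by
    by_contra! h
    exact hpq (h.1.trans ((meetB_comm hB p q).trans h.2.symm))
  rcases this with h | h
  · obtain ⟨π, hπ⟩ := exists_isMaxSeparating (L := Sig T) h
    refine ⟨π, ⟨_, _, meetB_meetB_left hB p q, hπ⟩, fun hp => hπ.2.1 ?_⟩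
    have := hπ.1.meetB (hπ.1.1.refl p) hp
    rwa [meetB_self hB] at this
  · obtain ⟨π, hπ⟩ := exists_isMaxSeparating (L := Sig T) h
    refine ⟨π, ⟨_, _, meetB_meetB_left hB q p, hπ⟩, fun hp => hπ.2.1 ?_⟩
    have := hπ.1.meetB (hπ.1.1.refl q) (hπ.1.1.symm hp)
    rwa [meetB_self hB] at this

theorem IsMaxSeparating.exists_polynomial (hB : InVariety T B) {i : Fin 3} {m n : B}
    (hmn : ∀ x, sB T i m n x x x = x) {a b : B} (hπ : IsMaxSeparating (Sig T) π a b)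
    {X : Type} {v : X → B} (hv : ∀ z, ∃ x, π z (v x)) {p q : B} (hpq : ¬ π p q) {x y : B}
    (hyx : meetB T x y = y) (hxy : ¬ π x y)
    (hab : ∀ θ : B → B → Prop, IsCongruence (Sig T) B θ → θ a b → θ x y) :
    ∃ t : (Sig T).Term (X ⊕ Unit), ¬ π (sB T i m n x y (t.realize (Sum.elim v fun _ => p)))
      (sB T i m n x y (t.realize (Sum.elim v fun _ => q))) := by
  by_contra! h
  have hg : ∀ z z', π z z' → π (sB T i m n x y z) (sB T i m n x y z') := fun z z' hz =>
    hπ.1.sB i (hπ.1.1.refl _) (hπ.1.1.refl _) hz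
  have hρ := isCongruence_polynomials hπ.1 hg hv
  have := hab _ hρ (hπ.2.2 _ hρ (fun _ _ => hπ.1.le_polynomials hg) p q h hpq)
    (Term.var (Sum.inr ()))
  simp only [Term.realize_var, Sum.elim_inr] at this
  rw [sB_self_right hB, hmn, sB_diag hB, hyx, hmn] at this
  exact hxy this

/-- Finitely many pairs of terms, each with distinct values modulo an irreducible congruence `π`,
jointly force a pair of terms with the same property. -/
theorem exists_forces (hB : InVariety T B) {i : Fin 3} {X : Type} {v : X → B} {m n a b : X}
    (hmn : ∀ x, sB T i (v m) (v n) x x x = x) (hba : meetB T (v a) (v b) = v b)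
    (hπ : IsMaxSeparating (Sig T) π (v a) (v b)) (hv : ∀ z, ∃ x, π z (v x))
    {l : Set ((Sig T).Term X × (Sig T).Term X)} (hl : l.Finite)
    (hne : ∀ p ∈ l, ¬ π (p.1.realize v) (p.2.realize v)) :
    ∃ r : (Sig T).Term X × (Sig T).Term X, ¬ π (r.1.realize v) (r.2.realize v) ∧
      ∀ p ∈ l, Forces (Sig T) (El T) p r := by
  induction l, hl using Set.Finite.induction_on with
  | empty => exact ⟨(Term.var a, Term.var b), hπ.2.1, by simp⟩
  | @insert q l _ _ ih =>
    obtain ⟨r, hr, hrl⟩ := ih fun p hp => hne p (Set.mem_insert_of_mem _ hp)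
    have hq := hne q (Set.mem_insert _ _)
    obtain ⟨t, ht⟩ := hπ.exists_polynomial hB hmn hv hr hba hπ.2.1 fun _ _ h => h
    let tm : (Sig T).Term X → (Sig T).Term X := fun z => t.subst (Sum.elim Term.var fun _ => z)
    have htm : ∀ {C : Type} [(Sig T).Structure C] (w : X → C) (z : (Sig T).Term X),
        (tm z).realize w = t.realize (Sum.elim w fun _ => z.realize w) := by
      intro C _ w z
      rw [Term.realize_subst]
      congr 1
      funext s
      rcases s with s | s <;> rfl
    let k : (Sig T).Term X → (Sig T).Term X := fun z =>
      sTm i (Term.var m) (Term.var n) (Term.var a) (Term.var b) (tm z)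
    have hk : ∀ {C : Type} [(Sig T).Structure C] {θ : C → C → Prop}, IsCongruence (Sig T) C θ →
        ∀ (w : X → C) {z z' : (Sig T).Term X}, θ (z.realize w) (z'.realize w) →
          θ ((k z).realize w) ((k z').realize w) := by
      intro C _ θ hθ w z z' h
      simp only [k, realize_sTm, htm]
      refine hθ.sB i (hθ.1.refl _) (hθ.1.refl _) (hθ.realize t ?_)
      rintro (s | s)
      exacts [hθ.1.refl _, h]
    have hkab : ∀ θ : B → B → Prop, IsCongruence (Sig T) B θ → θ (v a) (v b) →
        ∀ z, θ ((k z).realize v) (v a) := by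
      intro θ hθ hab z
      have := hθ.sB i (m := v m) (n := v n) (hθ.1.refl (v a)) (hθ.1.symm hab)
        (hθ.1.refl ((tm z).realize v))
      rw [sB_self_left hB, hmn] at this
      simpa [k] using this
    let d := meetTm (k r.1) (k r.2)
    obtain ⟨g, hg, hgd⟩ : ∃ g, (g = k r.1 ∨ g = k r.2) ∧ ¬ π (g.realize v) (d.realize v) := by
      by_contra! h
      refine ht ?_
      have := hπ.1.1.trans (h _ (Or.inl rfl)) (hπ.1.1.symm (h _ (Or.inr rfl)))
      simpa [k, htm] using this
    have hdg : meetB T (g.realize v) (d.realize v) = d.realize v := by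
      rcases hg with rfl | rfl
      · simp [d, meetB_meetB_left hB]
      · simp [d, meetB_comm hB ((k r.1).realize v), meetB_meetB_left hB]
    obtain ⟨t', ht'⟩ := hπ.exists_polynomial hB hmn hv hq hdg hgd fun θ hθ hab => by
      have hgz : ∃ z, g = k z := by rcases hg with rfl | rfl <;> exact ⟨_, rfl⟩
      obtain ⟨z, rfl⟩ := hgz
      have h₂ := hθ.meetB (hkab θ hθ hab r.1) (hkab θ hθ hab r.2)
      rw [meetB_self hB] at h₂
      exact hθ.1.trans (hkab θ hθ hab z) (hθ.1.symm (by simpa [d] using h₂))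
    let u : (Sig T).Term X → (Sig T).Term X := fun z =>
      sTm i (Term.var m) (Term.var n) g d (t'.subst (Sum.elim Term.var fun _ => z))
    have hu : ∀ {C : Type} [(Sig T).Structure C] (w : X → C) (z : (Sig T).Term X),
        (u z).realize w = sB T i (w m) (w n) (g.realize w) (d.realize w)
          (t'.realize (Sum.elim w fun _ => z.realize w)) := by
      intro C _ w z
      simp only [u, realize_sTm, Term.realize_var, Term.realize_subst]
      congr 2
      funext s
      rcases s with s | s <;> rfl
    refine ⟨(u q.1, u q.2), by simpa only [hu] using ht', ?_⟩
    intro p hp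
    rcases hp with rfl | hp
    · intro C _ hC θ hθ w h
      simp only [hu]
      refine hθ.sB i (hθ.1.refl _) (hθ.1.refl _) (hθ.realize t' ?_)
      rintro (s | s)
      exacts [hθ.1.refl _, h]
    · intro C _ hC θ hθ w h
      have h₁ := hk hθ w (hrl p hp C hC θ hθ w h)
      have h₂ : θ (g.realize w) (d.realize w) := by
        rcases hg with rfl | rfl
        · have := hθ.meetB (hθ.1.refl ((k r.1).realize w)) h₁
          rw [meetB_self hC] at this
          simpa [d] using this
        · have := hθ.meetB h₁ (hθ.1.refl ((k r.2).realize w))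
          rw [meetB_self hC] at this
          simpa [d] using hθ.1.symm this
      have h₃ : ∀ z, θ ((u z).realize w)
          (sB T i (w m) (w n) (g.realize w) (g.realize w) (g.realize w)) := by
        intro z
        rw [hu, ← sB_self_left hC]
        exact hθ.sB i (hθ.1.refl _) (hθ.1.symm h₂) (hθ.1.refl _)
      exact hθ.1.trans (h₃ _) (hθ.1.symm (h₃ _))

/-- Finite disjunctions of equations true in `A'(T)` hold modulo irreducible congruences. -/
theorem IsIrr.exists_realize (hB : InVariety T B) {i : Fin 3} {m n : B}
    (hmn : ∀ x, sB T i m n x x x = x) (hπ : IsIrr T π) {X : Type}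
    {l : Set ((Sig T).Term X × (Sig T).Term X)} (hl : l.Finite)
    (h : ∀ w : X → El T, ∃ p ∈ l, p.1.realize w = p.2.realize w) (v : X → B) :
    ∃ p ∈ l, π (p.1.realize v) (p.2.realize v) := by
  obtain ⟨a, b, hba, hπ⟩ := hπ
  by_contra! hne
  obtain ⟨r, hr, hforce⟩ := exists_forces hB (v := id) hmn hba hπ (fun z => ⟨z, hπ.1.1.refl z⟩)
    (hl.image fun p => (p.1.relabel v, p.2.relabel v)) (by
      rintro _ ⟨p, hp, rfl⟩
      simpa using hne p hp)
  refine hr ?_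
  rw [hB.realize_eq (p := r.1) (q := r.2) (fun w => ?_)]
  · exact hπ.1.1.refl _
  · obtain ⟨p, hp, hpw⟩ := h (w ∘ v)
    exact (hforce _ ⟨p, hp, rfl⟩).realize_eq (by simpa using hpw)

theorem IsIrr.meetB_eq_or (hB : InVariety T B) {i : Fin 3} {m n : B}
    (hmn : ∀ x, sB T i m n x x x = x) (hπ : IsIrr T π) (x y : B) :
    π (meetB T x y) x ∨ π (meetB T x y) (zeroB T B) := by
  simpa using hπ.exists_realize hB hmn
    (l := {(meetTm (Term.var 0) (Term.var 1), Term.var (0 : Fin 2)),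
      (meetTm (Term.var 0) (Term.var 1), zeroTm T _)}) (by simp)
    (fun w => by
      simp only [Set.mem_insert_iff, Set.mem_singleton_iff, exists_eq_or_imp, exists_eq_left,
        realize_meetTm, Term.realize_var, realize_zeroTm, meetB_el, zeroB_el, El.meet]
      grind)
    ![x, y]

theorem IsIrr.le_card [Finite (El T)] (hB : InVariety T B) {i : Fin 3} {m n : B}
    (hmn : ∀ x, sB T i m n x x x = x) (hπ : IsIrr T π) {k : ℕ} (u : Fin k → B)
    (hu : ∀ r s, r ≠ s → ¬ π (u r) (u s)) : k ≤ Nat.card (El T) := by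
  by_contra! hk
  obtain ⟨_, ⟨⟨r, s⟩, hrs, rfl⟩, h⟩ := hπ.exists_realize hB hmn
    (l := (fun p : Fin k × Fin k => (Term.var p.1, Term.var p.2)) '' {p | p.1 ≠ p.2})
    (Set.toFinite _)
    (fun w => by
      obtain ⟨r, s, hrs, h⟩ : ∃ r s, w r = w s ∧ r ≠ s := by
        by_contra! hw
        have := Nat.card_le_card_of_injective w hw
        rw [Nat.card_fin] at this
        omega
      exact ⟨_, ⟨(r, s), h, rfl⟩, hrs⟩) u
  exact hu r s hrs h

end Irreducible

section Join

open Language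

variable {T : TM} {B : Type} [(Sig T).Structure B]

/-- The iterated operation `S_i(m̄, x, S_i(m̄, x, …, z₂), z₁)` with innermost value `y`. -/
def joinB (T : TM) {B : Type} [(Sig T).Structure B] (i : Fin 3) (m n x y : B) (l : List B) : B :=
  l.foldr (fun z acc => sB T i m n x acc z) y

/-- The term for the iterated operation `joinB`. -/
def joinTm {X : Type} (i : Fin 3) (m n p q : (Sig T).Term X) (l : List ((Sig T).Term X)) :
    (Sig T).Term X :=
  l.foldr (fun z acc => sTm i m n p acc z) q

@[simp]
theorem realize_joinTm {X : Type} (i : Fin 3) (m n p q : (Sig T).Term X)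
    (l : List ((Sig T).Term X)) (v : X → B) :
    (joinTm i m n p q l).realize v =
      joinB T i (m.realize v) (n.realize v) (p.realize v) (q.realize v)
        (l.map fun z => z.realize v) := by
  induction l with
  | nil => rfl
  | cons z l ih =>
    change (sTm i m n p (joinTm i m n p q l) z).realize v = _
    rw [realize_sTm, ih]
    rfl

variable {π : B → B → Prop} (hB : InVariety T B) (hπ : IsCongruence (Sig T) B π) {i : Fin 3}
  {m n : B} (hmn : ∀ x, sB T i m n x x x = x) {x y : B} {l : List B}
include hB hπ hmn

theorem joinB_of_rel (h : π x y) : π (joinB T i m n x y l) x := by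
  induction l with
  | nil => exact hπ.1.symm h
  | cons z l ih =>
    have := hπ.sB i (m := m) (n := n) (hπ.1.refl x) ih (hπ.1.refl z)
    rwa [sB_self_left hB, hmn] at this

theorem joinB_of_mem (h : ∃ z ∈ l, π z x) : π (joinB T i m n x y l) x := by
  induction l with
  | nil => simp at h
  | cons z l ih =>
    rw [List.exists_mem_cons_iff] at h
    rcases h with h | h
    · have := hπ.sB i (m := m) (n := n) (hπ.1.refl x) (hπ.1.refl (joinB T i m n x y l)) h
      rwa [sB_self_right hB, hmn] at this
    · have := hπ.sB i (m := m) (n := n) (hπ.1.refl x) (ih h) (hπ.1.refl z)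
      rwa [sB_self_left hB, hmn] at this

theorem joinB_of_rel_zero (hy : π y (zeroB T B)) (hl : ∀ z ∈ l, π z (zeroB T B)) :
    π (joinB T i m n x y l) (zeroB T B) := by
  induction l with
  | nil => exact hy
  | cons z l ih =>
    have := hπ.sB i (m := m) (n := n) (hπ.1.refl x)
      (ih fun z hz => hl z (List.mem_cons_of_mem _ hz)) (hl z List.mem_cons_self)
    rwa [sB_diag hB, hmn, meetB_zero hB] at this

end Join

section Frame

open Language

variable {T : TM} {B : Type} [(Sig T).Structure B]

instance : Finite (El T) := by
  let f : El T → Fin 9 × Bool × Fin (T.states + 1) × Bool × Bool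
    | .zero => (0, false, 0, false, false)
    | .one => (1, false, 0, false, false)
    | .two => (2, false, 0, false, false)
    | .H => (3, false, 0, false, false)
    | .C b => (4, b, 0, false, false)
    | .D b => (5, b, 0, false, false)
    | .Cv b i r s => (6, b, i, r, s)
    | .Dv b i r s => (7, b, i, r, s)
    | .Mv b i r => (8, b, i, r, false)
  refine Finite.of_injective f fun x y h => ?_
  cases x <;> cases y <;> simp_all [f]

/-- The parameters `v` form a frame for the pair `(c, d)`: the pair is definable from `v`, and modulo
the irreducible congruences separating `c` and `d` the parameters cover the algebra and satisfy the
same equations. -/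
structure IsFrame {Y : Type} (v : Y → B) (c d : B) : Prop where
  exists_realize_left : ∃ P : (Sig T).Term Y, P.realize v = c
  exists_realize_right : ∃ Q : (Sig T).Term Y, Q.realize v = d
  exists_rel : ∀ π, IsIrr T π → ¬ π c d → ∀ z, ∃ y, π z (v y)
  transfer : ∀ π π', IsIrr T π → ¬ π c d → IsIrr T π' → ¬ π' c d → ∀ p q : (Sig T).Term Y,
    π (p.realize v) (q.realize v) → π' (p.realize v) (q.realize v)

theorem exists_isFrame (hB : InVariety T B) {i : Fin 3} {m n : B}
    (hmn : ∀ x, sB T i m n x x x = x) {a b : B} (hab : a ≠ b) :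
    ∃ (Y : Type) (_ : Finite Y) (v : Y → B) (α β μ ν : Y) (P Q : (Sig T).Term Y),
      Nat.card Y ≤ Nat.card (El T) + 6 ∧ v α = a ∧ v β = b ∧ v μ = m ∧ v ν = n ∧
        Forces (Sig T) (El T) (Term.var α, Term.var β) (P, Q) ∧ P.realize v ≠ Q.realize v ∧
          IsFrame (T := T) v (P.realize v) (Q.realize v) := by
  let S : Set ℕ := {k | ∃ π : B → B → Prop, IsIrr T π ∧ ¬ π a b ∧
    ∃ u : Fin k → B, ∀ r s, r ≠ s → ¬ π (u r) (u s)}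
  have hS : BddAbove S := ⟨Nat.card (El T), by
    rintro k ⟨π, hπ, -, u, hu⟩
    exact hπ.le_card hB hmn u hu⟩
  have hne : S.Nonempty := by
    obtain ⟨π, hπ, h⟩ := exists_isIrr hB hab
    exact ⟨0, π, hπ, h, Fin.elim0, fun r => r.elim0⟩
  obtain ⟨k, hk, hmax⟩ : ∃ k ∈ S, ∀ k' ∈ S, k' ≤ k :=
    ⟨sSup S, Nat.sSup_mem hne hS, fun _ h => le_csSup hS h⟩
  obtain ⟨π, hπ, hπab, u, hu⟩ := hk
  have hcover : ∀ θ : B → B → Prop, IsIrr T θ → ¬ θ a b → (∀ r s, r ≠ s → ¬ θ (u r) (u s)) →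
      ∀ z, ∃ s, θ z (u s) := by
    intro θ hθ hθab hθu z
    by_contra! hz
    have : k + 1 ∈ S := by
      refine ⟨θ, hθ, hθab, Fin.cons z u, fun r s hrs => ?_⟩
      induction r using Fin.cases with
      | zero =>
        induction s using Fin.cases with
        | zero => exact absurd rfl hrs
        | succ s => simpa using hz s
      | succ r =>
        induction s using Fin.cases with
        | zero => simpa using fun h => hz r (hθ.isCongruence.1.symm h)
        | succ s => simpa using hθu r s fun h => hrs (congrArg _ h)
    have := hmax _ this
    omega
  have hkcard := hπ.le_card hB hmn u hu
  obtain ⟨α₀, β₀, hβα, hmaxsep⟩ := id hπ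
  let v : Fin k ⊕ Fin 6 → B := Sum.elim u ![a, b, m, n, α₀, β₀]
  obtain ⟨R, hR, hrep⟩ := exists_finite_representatives (Sig T) (El T) (Fin k ⊕ Fin 6)
  let l : Set ((Sig T).Term (Fin k ⊕ Fin 6) × (Sig T).Term (Fin k ⊕ Fin 6)) :=
    insert (Term.var (Sum.inr 0), Term.var (Sum.inr 1))
      {p ∈ R ×ˢ R | ¬ π (p.1.realize v) (p.2.realize v)}
  obtain ⟨⟨P, Q⟩, hPQ, hforce⟩ := exists_forces hB (v := v) (m := Sum.inr 2) (n := Sum.inr 3)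
    (a := Sum.inr 4) (b := Sum.inr 5) (π := π) hmn hβα hmaxsep
    (fun z => let ⟨s, hs⟩ := hcover π hπ hπab hu z; ⟨Sum.inl s, hs⟩) (l := l)
    (((hR.prod hR).subset fun _ h => h.1).insert _)
    (by
      rintro p (rfl | hp)
      exacts [hπab, hp.2])
  have hsep : ∀ θ : B → B → Prop, IsIrr T θ → ¬ θ (P.realize v) (Q.realize v) →
      ∀ p q : (Sig T).Term (Fin k ⊕ Fin 6), θ (p.realize v) (q.realize v) →
        π (p.realize v) (q.realize v) := by
    intro θ hθ hθPQ p q hpq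
    by_contra hn
    obtain ⟨p', hp', hpp'⟩ := hrep p
    obtain ⟨q', hq', hqq'⟩ := hrep q
    rw [hB.realize_eq hpp', hB.realize_eq hqq'] at hn hpq
    exact hθPQ (hforce (p', q') (Or.inr ⟨⟨hp', hq'⟩, hn⟩) B hB θ hθ.isCongruence v hpq)
  have hθcover : ∀ θ : B → B → Prop, IsIrr T θ → ¬ θ (P.realize v) (Q.realize v) →
      ∀ z, ∃ s, θ z (u s) := by
    refine fun θ hθ hθPQ => hcover θ hθ
      (fun h => hθPQ (hforce _ (Or.inl rfl) B hB θ hθ.isCongruence v h)) fun r s hrs h => ?_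
    exact hu r s hrs (hsep θ hθ hθPQ (Term.var (Sum.inl r)) (Term.var (Sum.inl s)) h)
  have hback : ∀ θ : B → B → Prop, IsIrr T θ → ¬ θ (P.realize v) (Q.realize v) →
      ∀ p q : (Sig T).Term (Fin k ⊕ Fin 6), π (p.realize v) (q.realize v) →
        θ (p.realize v) (q.realize v) := by
    intro θ hθ hθPQ p q hpq
    obtain ⟨r, hr⟩ := hθcover θ hθ hθPQ (p.realize v)
    obtain ⟨s, hs⟩ := hθcover θ hθ hθPQ (q.realize v)
    have hr' : π (p.realize v) (u r) := hsep θ hθ hθPQ p (Term.var (Sum.inl r)) hr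
    have hs' : π (q.realize v) (u s) := hsep θ hθ hθPQ q (Term.var (Sum.inl s)) hs
    have hπ' := hπ.isCongruence.1
    have hrs : r = s := by
      by_contra hrs
      exact hu r s hrs (hπ'.trans (hπ'.symm hr') (hπ'.trans hpq hs'))
    subst hrs
    exact hθ.isCongruence.1.trans hr (hθ.isCongruence.1.symm hs)
  refine ⟨Fin k ⊕ Fin 6, inferInstance, v, Sum.inr 0, Sum.inr 1, Sum.inr 2, Sum.inr 3, P, Q, ?_,
    rfl, rfl, rfl, rfl, hforce _ (Or.inl rfl), fun h => hPQ ?_, ⟨P, rfl⟩, ⟨Q, rfl⟩, ?_, ?_⟩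
  · simpa using hkcard
  · change π (P.realize v) (Q.realize v)
    rw [h]
    exact hπ.isCongruence.1.refl _
  · exact fun θ hθ h z => let ⟨s, hs⟩ := hθcover θ hθ h z; ⟨Sum.inl s, hs⟩
  · exact fun θ θ' hθ h hθ' h' p q hpq => hback θ' hθ' h' p q (hsep θ hθ h p q hpq)

/-- Uniform terms separating the comparable pairs in `Cg(c, d)` whose upper element is the value
of the parameter `s`. -/
theorem IsFrame.exists_terms (hB : InVariety T B) {i : Fin 3} {m n : B}
    (hmn : ∀ x, sB T i m n x x x = x) {Y : Type} {v : Y → B} {c d : B}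
    (hv : IsFrame (T := T) v c d) (s : Y) :
    ∃ l r : (Sig T).Term (Fin 2 ⊕ Y),
      (∀ w : Fin 2 ⊕ Y → El T, w (Sum.inl 0) = w (Sum.inl 1) → l.realize w = r.realize w) ∧
      ∀ π, IsIrr T π → ¬ π c d → π (r.realize (Sum.elim ![c, d] v)) (zeroB T B) ∧
        ∀ x y, meetB T x y = y → PrinCg (Sig T) B c d x y → ¬ π x y → π x (v s) →
          π (l.realize (Sum.elim ![c, d] v)) x := by
  by_cases hex : ∃ π, IsIrr T π ∧ ¬ π c d ∧ ∃ x y, meetB T x y = y ∧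
    PrinCg (Sig T) B c d x y ∧ ¬ π x y ∧ π x (v s)
  · obtain ⟨π, hπ, hπcd, x, y, hyx, hxy, hπxy, hxs⟩ := hex
    have hcon := hπ.isCongruence
    obtain ⟨P, rfl⟩ := hv.exists_realize_left
    obtain ⟨Q, rfl⟩ := hv.exists_realize_right
    obtain ⟨t, ht⟩ : ∃ t : (Sig T).Term (Y ⊕ Unit),
        ¬ π (meetB T x (t.realize (Sum.elim v fun _ => P.realize v)))
          (meetB T x (t.realize (Sum.elim v fun _ => Q.realize v))) := by
      by_contra! h
      have := hxy _ (isCongruence_polynomials hcon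
        (fun z z' hz => hcon.meetB (hcon.1.refl x) hz) (hv.exists_rel π hπ hπcd)) h
        (Term.var (Sum.inr ()))
      simp only [Term.realize_var, Sum.elim_inr] at this
      rw [meetB_self hB, hyx] at this
      exact hπxy this
    let f : Fin 2 → B := fun j => t.realize (Sum.elim v fun _ => ![P.realize v, Q.realize v] j)
    obtain ⟨j, j', hj, hj'⟩ : ∃ j j', π (meetB T x (f j)) x ∧ π (meetB T x (f j')) (zeroB T B) := by
      rcases hπ.meetB_eq_or hB hmn x (f 0) with h₀ | h₀ <;>
        rcases hπ.meetB_eq_or hB hmn x (f 1) with h₁ | h₁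
      · exact absurd (hcon.1.trans h₀ (hcon.1.symm h₁)) ht
      · exact ⟨0, 1, h₀, h₁⟩
      · exact ⟨1, 0, h₁, h₀⟩
      · exact absurd (hcon.1.trans h₀ (hcon.1.symm h₁)) ht
    let tm : Fin 2 → (Sig T).Term (Fin 2 ⊕ Y) := fun j => meetTm (Term.var (Sum.inr s))
      (t.subst (Sum.elim (fun y => Term.var (Sum.inr y)) fun _ => Term.var (Sum.inl j)))
    let tm' : Fin 2 → (Sig T).Term Y := fun j => meetTm (Term.var s)
      (t.subst (Sum.elim Term.var fun _ => ![P, Q] j))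
    have htm : ∀ j, (tm j).realize (Sum.elim ![P.realize v, Q.realize v] v) =
        meetB T (v s) (f j) := by
      intro j
      simp only [tm, f, realize_meetTm, Term.realize_var, Sum.elim_inr, Term.realize_subst]
      congr 2
      funext z
      rcases z with z | z <;> rfl
    have htm' : ∀ j, (tm' j).realize v = meetB T (v s) (f j) := by
      intro j
      simp only [tm', f, realize_meetTm, Term.realize_var, Term.realize_subst]
      congr 2
      funext z
      rcases z with z | z
      · rfl
      · fin_cases j <;> rfl
    have hxf : ∀ j, π (meetB T (v s) (f j)) (meetB T x (f j)) := fun j =>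
      hcon.meetB (hcon.1.symm hxs) (hcon.1.refl _)
    refine ⟨tm j, tm j', fun w hw => ?_, fun θ hθ hθcd => ?_⟩
    · have : w (Sum.inl j) = w (Sum.inl j') := by
        fin_cases j <;> fin_cases j' <;> simp [hw]
      simp only [tm, realize_meetTm, Term.realize_var, Term.realize_subst]
      congr 2
      funext z
      rcases z with z | z
      · rfl
      · exact this
    · have h₁ := hv.transfer π θ hπ hπcd hθ hθcd (tm' j) (Term.var s) (by
        rw [htm']
        exact hcon.1.trans (hxf j) (hcon.1.trans hj hxs))
      have h₂ := hv.transfer π θ hπ hπcd hθ hθcd (tm' j') (zeroTm T Y) (by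
        rw [htm', realize_zeroTm]
        exact hcon.1.trans (hxf j') hj')
      rw [htm'] at h₁ h₂
      rw [realize_zeroTm] at h₂
      rw [htm, htm]
      exact ⟨h₂, fun x _ _ _ _ hx => hθ.isCongruence.1.trans h₁ (hθ.isCongruence.1.symm hx)⟩
  · refine ⟨zeroTm T _, zeroTm T _, fun _ _ => rfl, fun π hπ hπcd => ⟨?_, ?_⟩⟩
    · rw [realize_zeroTm]
      exact hπ.isCongruence.1.refl _
    · intro x y hyx hxy hn hs
      exact absurd ⟨π, hπ, hπcd, x, y, hyx, hxy, hn, hs⟩ hex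

theorem IsFrame.termRelated (hB : InVariety T B) {i : Fin 3} {Y : Type} [Finite Y] {v : Y → B}
    {μ ν : Y} (hmn : ∀ x, sB T i (v μ) (v ν) x x x = x) {c d : B}
    (hv : IsFrame (T := T) v c d) {x y : B} (hyx : meetB T x y = y)
    (hxy : PrinCg (Sig T) B c d x y) {N : ℕ} (hN : Nat.card Y + 2 ≤ N) :
    TermRelated (Sig T) (El T) N x y c d := by
  choose l r hlr h using hv.exists_terms hB hmn
  have := Fintype.ofFinite Y
  let e : Fin 2 ⊕ Y → Fin 2 ⊕ (Y ⊕ Fin 2) := Sum.map id Sum.inl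
  let W : (Y → (Sig T).Term (Fin 2 ⊕ Y)) → (Sig T).Term (Fin 2 ⊕ (Y ⊕ Fin 2)) := fun g =>
    joinTm i (Term.var (Sum.inr (Sum.inl μ))) (Term.var (Sum.inr (Sum.inl ν)))
      (Term.var (Sum.inr (Sum.inr 0))) (Term.var (Sum.inr (Sum.inr 1)))
      (Finset.univ.toList.map fun s => (g s).relabel e)
  have he : Sum.elim ![c, d] (Sum.elim v ![x, y]) ∘ e = Sum.elim ![c, d] v := by
    funext z
    rcases z with z | z <;> rfl
  have hW : ∀ g, (W g).realize (Sum.elim ![c, d] (Sum.elim v ![x, y])) =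
      joinB T i (v μ) (v ν) x y
        (Finset.univ.toList.map fun s => (g s).realize (Sum.elim ![c, d] v)) := by
    intro g
    simp [W, Function.comp_def, Term.realize_relabel, ← he]
  refine TermRelated.of_card_le (Z := Y ⊕ Fin 2) (by simpa using hN) (Sum.elim v ![x, y])
    (W l) (W r) (fun w hw => ?_) ?_ ?_
  · simp only [W, realize_joinTm, List.map_map, Function.comp_def, Term.realize_relabel]
    congr 2
    funext s
    exact hlr s _ hw
  · rw [hW]
    by_contra hne
    obtain ⟨π, hπ, hn⟩ := exists_isIrr hB hne
    have hcon := hπ.isCongruence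
    by_cases hπxy : π x y
    · exact hn (joinB_of_rel hB hcon hmn hπxy)
    · have hπcd : ¬ π c d := fun h => hπxy (hxy π hcon h)
      obtain ⟨s, hs⟩ := hv.exists_rel π hπ hπcd x
      exact hn (joinB_of_mem hB hcon hmn
        ⟨_, List.mem_map.2 ⟨s, by simp, rfl⟩, (h s π hπ hπcd).2 x y hyx hxy hπxy hs⟩)
  · rw [hW]
    by_contra hne
    obtain ⟨π, hπ, hn⟩ := exists_isIrr hB hne
    have hcon := hπ.isCongruence
    by_cases hπxy : π x y
    · exact hn (hcon.1.trans (joinB_of_rel hB hcon hmn hπxy) hπxy)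
    · have hπcd : ¬ π c d := fun h => hπxy (hxy π hcon h)
      have hy : π y (zeroB T B) := by
        have := hπ.meetB_eq_or hB hmn x y
        rw [hyx] at this
        exact this.resolve_left fun h => hπxy (hcon.1.symm h)
      refine hn (hcon.1.trans (joinB_of_rel_zero hB hcon hmn hy ?_) (hcon.1.symm hy))
      intro z hz
      obtain ⟨s, -, rfl⟩ := List.mem_map.1 hz
      exact (h s π hπ hπcd).1

/-- Principal subcongruences of algebras with a unit for some `e_i` are given by terms in a bounded
number of parameters. -/
theorem exists_termRelated (hB : InVariety T B) {i : Fin 3} {m n : B}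
    (hmn : ∀ x, sB T i m n x x x = x) {a b : B} (hab : a ≠ b) :
    ∃ c d : B, c ≠ d ∧ TermRelated (Sig T) (El T) (Nat.card (El T) + 8) c d a b ∧
      ∀ x y, meetB T x y = y → PrinCg (Sig T) B c d x y →
        TermRelated (Sig T) (El T) (Nat.card (El T) + 8) x y c d := by
  classical
  obtain ⟨Y, _, v, α, β, μ, ν, P, Q, hY, hα, hβ, rfl, rfl, hforce, hPQ, hv⟩ :=
    exists_isFrame hB hmn hab
  refine ⟨_, _, hPQ, ?_, fun x y hyx hxy => hv.termRelated hB hmn hyx hxy (by omega)⟩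
  let σ : Y → Fin 2 ⊕ Y := fun y =>
    if y = α then Sum.inl 0 else if y = β then Sum.inl 1 else Sum.inr y
  have hσ : Sum.elim ![a, b] v ∘ σ = v := by
    funext y
    by_cases hyα : y = α
    · simp [σ, hyα, hα]
    · by_cases hyβ : y = β
      · subst hyβ
        simp [σ, hyα, hβ]
      · simp [σ, hyα, hyβ]
  refine TermRelated.of_card_le (Z := Y) (by omega) v (P.relabel σ) (Q.relabel σ)
    (fun w hw => ?_) (by rw [Term.realize_relabel, hσ]) (by rw [Term.realize_relabel, hσ])
  rw [Term.realize_relabel, Term.realize_relabel]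
  refine hforce.realize_eq ?_
  by_cases hαβ : β = α
  · simp [hαβ]
  · simp [σ, hαβ, hw]

theorem prinCg_iff_meetB (hB : InVariety T B) {c d x y : B} :
    PrinCg (Sig T) B c d x y ↔
      PrinCg (Sig T) B c d x (meetB T x y) ∧ PrinCg (Sig T) B c d y (meetB T x y) := by
  constructor
  · refine fun h => ⟨fun θ hθ hcd => ?_, fun θ hθ hcd => ?_⟩
    · have := hθ.meetB (hθ.1.refl x) (h θ hθ hcd)
      rwa [meetB_self hB] at this
    · have := hθ.meetB (h θ hθ hcd) (hθ.1.refl y)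
      rw [meetB_self hB] at this
      exact hθ.1.symm this
  · exact fun h θ hθ hcd => hθ.1.trans (h.1 θ hθ hcd) (hθ.1.symm (h.2 θ hθ hcd))

theorem hasDPSC_MiClass (T : TM) (i : Fin 3) : HasDPSC (Sig T) (MiClass T i) := by
  obtain ⟨φ, hφ⟩ := exists_termRelated_formula (Sig T) (El T) (Nat.card (El T) + 8)
  let σ : Fin 2 → Fin 4 → (Sig T).Term (Fin 4) := fun j =>
    ![Term.var (![0, 1] j), meetTm (Term.var 0) (Term.var 1), Term.var 2, Term.var 3]
  have hσ : ∀ {B : Type} [(Sig T).Structure B] (x y c d : B) (j : Fin 2),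
      Formula.Realize (BoundedFormula.subst φ (σ j)) ![x, y, c, d] ↔
        φ.Realize ![![x, y] j, meetB T x y, c, d] := by
    intro B _ x y c d j
    unfold Formula.Realize
    rw [BoundedFormula.realize_subst]
    suffices (fun k => (σ j k).realize ![x, y, c, d]) = ![![x, y] j, meetB T x y, c, d] by
      rw [this]
    funext k
    fin_cases k
    · fin_cases j <;> rfl
    · exact realize_meetTm (B := B) _ _ _
    · rfl
    · rfl
  refine ⟨φ, BoundedFormula.subst φ (σ 0) ⊓ BoundedFormula.subst φ (σ 1), ?_, ?_, ?_⟩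
  · intro B _ hB w x y z h
    exact ((hφ B hB.1 _ _ _ _).1 h).prinCg hB.1
  · intro B _ hB w x y z h
    rw [Formula.realize_inf, hσ, hσ, hφ B hB.1, hφ B hB.1] at h
    exact (prinCg_iff_meetB hB.1).2 ⟨h.1.prinCg hB.1, h.2.prinCg hB.1⟩
  · rintro B _ ⟨hB, τ, hτ, hx⟩ a b hab
    obtain ⟨m, n, hmn⟩ := exists_sB_of_tag (T := T) hτ
    obtain ⟨c, d, hcd, hrel, h⟩ :=
      exists_termRelated hB (fun x => (hmn x).trans (hx x)) hab
    refine ⟨c, d, hcd, (hφ B hB _ _ _ _).2 hrel, fun x y => ?_⟩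
    rw [Formula.realize_inf, hσ, hσ, hφ B hB, hφ B hB, prinCg_iff_meetB hB]
    refine ⟨fun hxy => ⟨h _ _ (meetB_meetB_left hB x y) hxy.1, h _ _ ?_ hxy.2⟩,
      fun hxy => ⟨hxy.1.prinCg hB, hxy.2.prinCg hB⟩⟩
    simp [meetB_comm hB x y, meetB_meetB_left hB]

end Frame

/-- If the Turing machine `T` halts, then for each `i ∈ {0,1,2}`
the class `M_i` of all algebras of `V(A'(T))` satisfying `∃ m̄ [e_i(m̄,x) ≈ x]`
has definable principal subcongruences. -/
theorem MiClass_hasDPSC (T : TM) (h : T.Halts) :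
    ∀ i : Fin 3, HasDPSC (Sig T) (MiClass T i) := by
  exact fun i => hasDPSC_MiClass T i

end McKenzie
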